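/- Let 1<p<∞, p′ = p/(p−1), let w ∈ A_p on ℝ^d, set σ := w^{1−p′}, let 𝒟 be the standard dyadic grid and M_𝒟 the dyadic maximal operator. Then for every dyadic cube I ∈ 𝒟, ∫_I M_𝒟(σχ_I)^p w dx ≤ C(p,d) ‖w‖_{A_p}^{p′} σ(I). -/

import Mathlib

open MeasureTheory Set ENNReal

noncomputable section

/-- An axis-parallel cube in `ℝ^d` with corner `x` and side length `h`. -/
def cube (d : ℕ) (x : Fin d → ℝ) (h : ℝ) : Set (Fin d → ℝ) :=
  Set.univ.pi fun i => Set.Ico (x i) (x i + h)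

/-- The average of (the nonnegative part of) `w` over a set `I`, valued in `ℝ≥0∞`. -/
def lavg (d : ℕ) (w : (Fin d → ℝ) → ℝ) (I : Set (Fin d → ℝ)) : ℝ≥0∞ :=
  (volume I)⁻¹ * ∫⁻ y in I, ENNReal.ofReal (w y)

/-- The `A_p` characteristic of a weight `w` on `ℝ^d`:
the supremum over all cubes `I` of `(|I|⁻¹∫_I w)·(|I|⁻¹∫_I w^{-1/(p-1)})^{p-1}`. -/
def ApChar (d : ℕ) (p : ℝ) (w : (Fin d → ℝ) → ℝ) : ℝ≥0∞ :=
  ⨆ (x : Fin d → ℝ) (h : Set.Ioi (0:ℝ)),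
    lavg d w (cube d x h) *
      (lavg d (fun y => w y ^ (-1 / (p - 1))) (cube d x h)) ^ (p - 1)

/-- A weight on `ℝ^d`: a measurable, locally integrable, a.e. positive function. -/
def IsWeight (d : ℕ) (w : (Fin d → ℝ) → ℝ) : Prop :=
  Measurable w ∧ LocallyIntegrable w volume ∧ ∀ᵐ x : Fin d → ℝ, 0 < w x

/-- The standard dyadic cube `2^{-k}(n + [0,1)^d)` in `ℝ^d`. -/
def dyadicCube (d : ℕ) (k : ℤ) (n : Fin d → ℤ) : Set (Fin d → ℝ) :=
  Set.univ.pi fun i => Set.Ico ((n i : ℝ) * (2:ℝ) ^ (-k)) (((n i : ℝ) + 1) * (2:ℝ) ^ (-k))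

/-- The dyadic maximal operator `M_𝒟 g(x) := sup_{I∈𝒟, x∈I} |I|⁻¹ ∫_I |g|`. -/
def dyadicMax (d : ℕ) (g : (Fin d → ℝ) → ℝ) (x : Fin d → ℝ) : ℝ≥0∞ :=
  ⨆ (k : ℤ) (n : Fin d → ℤ) (_ : x ∈ dyadicCube d k n),
    (volume (dyadicCube d k n))⁻¹ * ∫⁻ y in dyadicCube d k n, (‖g y‖₊ : ℝ≥0∞)

open scoped NNReal

theorem mul_measure_biUnion_le_of_laminar {α ι : Type*} [MeasurableSpace α] (μ ν : Measure α)
    (s : Finset ι) (J : ι → Set α) (hJ : ∀ i, MeasurableSet (J i))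
    (lam : ∀ i j, J i ⊆ J j ∨ J j ⊆ J i ∨ Disjoint (J i) (J j)) (c : ℝ≥0∞)
    (h : ∀ i ∈ s, c * ν (J i) ≤ μ (J i)) :
    c * ν (⋃ i ∈ s, J i) ≤ μ (⋃ i ∈ s, J i) := by
  classical
  set M : Finset (Set α) := (s.image J).filter (Maximal (· ∈ s.image J)) with hM
  have hMs : ∀ A ∈ M, ∃ i ∈ s, J i = A := fun A hA =>
    Finset.mem_image.mp (Finset.mem_filter.mp hA).1
  have hU : ⋃ i ∈ s, J i = ⋃ A ∈ M, A := by
    apply Subset.antisymm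
    · refine iUnion₂_subset fun i hi => ?_
      obtain ⟨A, hA, hmax⟩ := (s.image J).exists_le_maximal (Finset.mem_image_of_mem J hi)
      exact Subset.trans hA (subset_biUnion_of_mem (u := fun A : Set α => A)
        (Finset.mem_coe.mpr (Finset.mem_filter.mpr ⟨hmax.1, hmax⟩)))
    · refine iUnion₂_subset fun A hA => ?_
      obtain ⟨i, hi, rfl⟩ := hMs A hA
      exact subset_biUnion_of_mem (u := J) (Finset.mem_coe.mpr hi)
  have hdisj : (M : Set (Set α)).PairwiseDisjoint (fun A => A) := by
    intro A hA B hB hAB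
    obtain ⟨i, -, rfl⟩ := hMs A hA
    obtain ⟨j, -, rfl⟩ := hMs B hB
    have hmi := (Finset.mem_filter.mp hA).2
    have hmj := (Finset.mem_filter.mp hB).2
    rcases lam i j with h1 | h1 | h1
    · exact absurd (Subset.antisymm h1 (hmi.2 hmj.1 h1)) hAB
    · exact absurd (Subset.antisymm (hmj.2 hmi.1 h1) h1) hAB
    · exact h1
  have hmeas : ∀ A ∈ M, MeasurableSet A := by
    intro A hA
    obtain ⟨i, -, rfl⟩ := hMs A hA
    exact hJ i
  rw [hU, measure_biUnion_finset hdisj hmeas, measure_biUnion_finset hdisj hmeas, Finset.mul_sum]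
  refine Finset.sum_le_sum fun A hA => ?_
  obtain ⟨i, hi, rfl⟩ := hMs A hA
  exact h i hi

/-- The maximal function `x ↦ max {c i | i ∈ s, x ∈ J i}` of a finite family of sets. -/
def finMax {α ι : Type*} (J : ι → Set α) (c : ι → ℝ≥0) (s : Finset ι) (x : α) : ℝ≥0 :=
  s.sup fun i => (J i).indicator (fun _ => c i) x

theorem measurable_finMax {α ι : Type*} [MeasurableSpace α] {J : ι → Set α}
    (hJ : ∀ i, MeasurableSet (J i)) (c : ι → ℝ≥0) (s : Finset ι) :
    Measurable (finMax J c s) := by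
  classical
  induction s using Finset.induction_on with
  | empty =>
    have : finMax J c ∅ = fun _ => 0 := by ext; simp [finMax]
    rw [this]
    exact measurable_const
  | insert a s ha ih =>
    have : finMax J c (insert a s) =
        fun x => (J a).indicator (fun _ => c a) x ⊔ finMax J c s x := by
      funext x; simp [finMax, Finset.sup_insert]
    rw [this]
    exact (measurable_const.indicator (hJ a)).sup ih

theorem setOf_lt_finMax {α ι : Type*} (J : ι → Set α) (c : ι → ℝ≥0) (s : Finset ι)
    {t : ℝ} (ht : 0 < t) :
    {x | t < (finMax J c s x : ℝ)} = ⋃ i ∈ s.filter (fun i => t < (c i : ℝ)), J i := by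
  lift t to ℝ≥0 using ht.le
  ext x
  simp only [mem_ofPred_eq, NNReal.coe_lt_coe, finMax, Finset.lt_sup_iff, Finset.mem_filter,
    mem_iUnion, exists_prop, and_assoc]
  refine exists_congr fun i => and_congr_right fun _ => ?_
  by_cases hx : x ∈ J i
  · simp [hx]
  · simp [hx]

theorem lintegral_finMax_rpow_le_mul {α ι : Type*} [MeasurableSpace α] (μ ν : Measure α)
    {J : ι → Set α} (hJ : ∀ i, MeasurableSet (J i))
    (lam : ∀ i j, J i ⊆ J j ∨ J j ⊆ J i ∨ Disjoint (J i) (J j)) {c : ι → ℝ≥0}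
    (h : ∀ i, c i * ν (J i) ≤ μ (J i)) (s : Finset ι) {q : ℝ} (hq : 1 < q) :
    ∫⁻ x, (finMax J c s x : ℝ≥0∞) ^ q ∂ν ≤
      ENNReal.ofReal (q / (q - 1)) * ∫⁻ x, (finMax J c s x : ℝ≥0∞) ^ (q - 1) ∂μ := by
  have hF : Measurable fun x => (finMax J c s x : ℝ) := (measurable_finMax hJ c s).coe_nnreal_real
  have hcoe : ∀ (r : ℝ), 0 ≤ r → ∀ x, (finMax J c s x : ℝ≥0∞) ^ r =
      ENNReal.ofReal ((finMax J c s x : ℝ) ^ r) := by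
    intro r hr x
    rw [← ENNReal.ofReal_rpow_of_nonneg (NNReal.coe_nonneg _) hr, ENNReal.ofReal_coe_nnreal]
  have hnn : ∀ (m : Measure α), 0 ≤ᵐ[m] fun x => (finMax J c s x : ℝ) :=
    fun m => Filter.Eventually.of_forall fun x => NNReal.coe_nonneg _
  have hq1 : 0 < q - 1 := by linarith
  simp_rw [hcoe q (by linarith), hcoe (q - 1) hq1.le]
  rw [lintegral_rpow_eq_lintegral_meas_lt_mul ν (hnn ν) hF.aemeasurable (by linarith),
    lintegral_rpow_eq_lintegral_meas_lt_mul μ (hnn μ) hF.aemeasurable hq1, ← mul_assoc,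
    ← ENNReal.ofReal_mul (by positivity), div_mul_cancel₀ _ hq1.ne']
  refine mul_le_mul_right (setLIntegral_mono' measurableSet_Ioi fun t ht => ?_) _
  have ht : 0 < t := ht
  have hw : ENNReal.ofReal t * ν {x | t < (finMax J c s x : ℝ)} ≤
      μ {x | t < (finMax J c s x : ℝ)} := by
    rw [setOf_lt_finMax J c s ht]
    refine mul_measure_biUnion_le_of_laminar μ ν _ J hJ lam _ fun i hi => le_trans ?_ (h i)
    gcongr
    exact (ENNReal.ofReal_le_ofReal (Finset.mem_filter.mp hi).2.le).trans
      (ENNReal.ofReal_coe_nnreal).le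
  calc ν {x | t < (finMax J c s x : ℝ)} * ENNReal.ofReal (t ^ (q - 1))
      = ENNReal.ofReal t * ν {x | t < (finMax J c s x : ℝ)} * ENNReal.ofReal (t ^ (q - 1 - 1)) := by
        rw [Real.rpow_sub_one ht.ne' (q - 1), mul_comm (ENNReal.ofReal t), mul_assoc,
          ← ENNReal.ofReal_mul ht.le, mul_div_cancel₀ _ ht.ne']
    _ ≤ _ := mul_le_mul_left hw _

theorem le_rpow_mul_of_le_mul_rpow_mul_rpow {a b k : ℝ≥0∞} {q : ℝ} (hq : 1 < q) (ha : a ≠ ⊤)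
    (h : a ≤ k * (b ^ (1 / q) * a ^ ((q - 1) / q))) : a ≤ k ^ q * b := by
  rcases eq_or_ne a 0 with rfl | ha0
  · exact zero_le
  have hq0 : 0 < q := by linarith
  have h1 : a ^ (1 / q) ≤ k * b ^ (1 / q) := by
    have hpos : a ^ ((q - 1) / q) ≠ 0 := by
      simp [ENNReal.rpow_eq_zero_iff, ha0, ha]
    have hfin : a ^ ((q - 1) / q) ≠ ⊤ :=
      ENNReal.rpow_ne_top_of_nonneg (div_nonneg (by linarith) hq0.le) ha
    rw [← ENNReal.mul_le_mul_iff_left hpos hfin, ← ENNReal.rpow_add _ _ ha0 ha, mul_assoc]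
    convert h using 1
    rw [← add_div]; simp [hq0.ne']
  have h2 := ENNReal.rpow_le_rpow h1 hq0.le
  rwa [ENNReal.mul_rpow_of_nonneg _ _ hq0.le, ← ENNReal.rpow_mul, ← ENNReal.rpow_mul,
    one_div_mul_cancel hq0.ne', ENNReal.rpow_one, ENNReal.rpow_one] at h2

theorem lintegral_finMax_rpow_le {α ι : Type*} [MeasurableSpace α] (ν : Measure α)
    [IsFiniteMeasure ν] {f : α → ℝ≥0∞} (hf : Measurable f)
    {J : ι → Set α} (hJ : ∀ i, MeasurableSet (J i))
    (lam : ∀ i j, J i ⊆ J j ∨ J j ⊆ J i ∨ Disjoint (J i) (J j)) {c : ι → ℝ≥0}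
    (h : ∀ i, c i * ν (J i) ≤ ν.withDensity f (J i)) (s : Finset ι) {q : ℝ} (hq : 1 < q) :
    ∫⁻ x, (finMax J c s x : ℝ≥0∞) ^ q ∂ν ≤
      ENNReal.ofReal (q / (q - 1)) ^ q * ∫⁻ x, f x ^ q ∂ν := by
  have hq0 : 0 < q := by linarith
  have hq1 : 0 < q - 1 := by linarith
  have hF : Measurable fun x => (finMax J c s x : ℝ≥0∞) :=
    (measurable_finMax hJ c s).coe_nnreal_ennreal
  refine le_rpow_mul_of_le_mul_rpow_mul_rpow hq ?_ ?_
  · have hb : ∀ x, (finMax J c s x : ℝ≥0∞) ^ q ≤ ((s.sup c : ℝ≥0) : ℝ≥0∞) ^ q := by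
      intro x
      refine ENNReal.rpow_le_rpow (ENNReal.coe_le_coe.mpr ?_) hq0.le
      exact Finset.sup_mono_fun fun i _ => indicator_le_self' (fun _ _ => zero_le) x
    refine ((lintegral_mono hb).trans_lt ?_).ne
    rw [lintegral_const]
    exact ENNReal.mul_lt_top (ENNReal.rpow_lt_top_of_nonneg hq0.le ENNReal.coe_ne_top)
      (measure_lt_top _ _)
  · refine (lintegral_finMax_rpow_le_mul (ν.withDensity f) ν hJ lam h s hq).trans ?_
    refine mul_le_mul_right ?_ _
    rw [lintegral_withDensity_eq_lintegral_mul _ hf (hF.pow_const _)]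
    have hpq : q.HolderConjugate (q / (q - 1)) := Real.HolderConjugate.conjExponent hq
    refine (ENNReal.lintegral_mul_le_Lp_mul_Lq ν hpq hf.aemeasurable
      (hF.pow_const _).aemeasurable).trans (le_of_eq ?_)
    congr 2
    · refine lintegral_congr fun x => ?_
      rw [← ENNReal.rpow_mul, mul_div_cancel₀ _ hq1.ne']
    · rw [one_div_div]

/-- The `L^q(ν)` bound for the maximal function of a countable laminar family. -/
theorem lintegral_iSup_indicator_rpow_le {α ι : Type*} [Countable ι] [MeasurableSpace α]
    (ν : Measure α) [IsFiniteMeasure ν] {f : α → ℝ≥0∞} (hf : Measurable f)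
    {J : ι → Set α} (hJ : ∀ i, MeasurableSet (J i))
    (lam : ∀ i j, J i ⊆ J j ∨ J j ⊆ J i ∨ Disjoint (J i) (J j)) {c : ι → ℝ≥0}
    (h : ∀ i, c i * ν (J i) ≤ ν.withDensity f (J i)) {q : ℝ} (hq : 1 < q) :
    ∫⁻ x, (⨆ i, (J i).indicator (fun _ => (c i : ℝ≥0∞)) x) ^ q ∂ν ≤
      ENNReal.ofReal (q / (q - 1)) ^ q * ∫⁻ x, f x ^ q ∂ν := by
  classical
  have hq0 : 0 < q := by linarith
  have hmono : ∀ x, Monotone fun s : Finset ι => (finMax J c s x : ℝ≥0∞) ^ q := fun x s t hst =>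
    ENNReal.rpow_le_rpow (ENNReal.coe_le_coe.mpr (Finset.sup_mono hst)) hq0.le
  calc ∫⁻ x, (⨆ i, (J i).indicator (fun _ => (c i : ℝ≥0∞)) x) ^ q ∂ν
      ≤ ∫⁻ x, ⨆ s : Finset ι, (finMax J c s x : ℝ≥0∞) ^ q ∂ν := by
        refine lintegral_mono fun x => ?_
        have hi := (ENNReal.orderIsoRpow q hq0).map_iSup
          fun i => (J i).indicator (fun _ => (c i : ℝ≥0∞)) x
        simp only [ENNReal.orderIsoRpow_apply] at hi
        simp only
        rw [hi]
        refine iSup_le fun i => le_iSup_of_le {i} ?_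
        refine ENNReal.rpow_le_rpow (le_of_eq ?_) hq0.le
        by_cases hx : x ∈ J i <;> simp [finMax, hx]
    _ = ⨆ s : Finset ι, ∫⁻ x, (finMax J c s x : ℝ≥0∞) ^ q ∂ν := by
        refine lintegral_iSup_directed (fun s =>
          ((measurable_finMax hJ c s).coe_nnreal_ennreal.pow_const _).aemeasurable) ?_
        exact Monotone.directed_le fun s t hst x => hmono x hst
    _ ≤ _ := iSup_le fun s => lintegral_finMax_rpow_le ν hf hJ lam h s hq

theorem dyadicCube_eq_cube (d : ℕ) (k : ℤ) (n : Fin d → ℤ) :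
    dyadicCube d k n = cube d (fun i => (n i : ℝ) * (2:ℝ) ^ (-k)) ((2:ℝ) ^ (-k)) := by
  simp only [dyadicCube, cube, add_mul, one_mul]

theorem measurableSet_dyadicCube (d : ℕ) (k : ℤ) (n : Fin d → ℤ) :
    MeasurableSet (dyadicCube d k n) :=
  MeasurableSet.univ_pi fun _ => measurableSet_Ico

theorem volume_dyadicCube (d : ℕ) (k : ℤ) (n : Fin d → ℤ) :
    volume (dyadicCube d k n) = ENNReal.ofReal ((2:ℝ) ^ (-k)) ^ d := by
  rw [dyadicCube, Real.volume_pi_Ico]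
  simp [add_mul]

theorem volume_dyadicCube_ne_zero (d : ℕ) (k : ℤ) (n : Fin d → ℤ) :
    volume (dyadicCube d k n) ≠ 0 := by
  rw [volume_dyadicCube]
  exact pow_ne_zero _ (ENNReal.ofReal_pos.mpr (by positivity)).ne'

theorem volume_dyadicCube_ne_top (d : ℕ) (k : ℤ) (n : Fin d → ℤ) :
    volume (dyadicCube d k n) ≠ ⊤ := by
  rw [volume_dyadicCube]
  exact ENNReal.pow_ne_top ENNReal.ofReal_ne_top

theorem dyadicCube_subset_of_le {d : ℕ} {k k' : ℤ} (hk : k ≤ k') {n n' : Fin d → ℤ}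
    {x : Fin d → ℝ} (hx : x ∈ dyadicCube d k n) (hx' : x ∈ dyadicCube d k' n') :
    dyadicCube d k' n' ⊆ dyadicCube d k n := by
  obtain ⟨m, rfl⟩ := Int.le.dest hk
  intro y hy i _
  have h1 := hx i (mem_univ i)
  have h2 := hx' i (mem_univ i)
  have h3 := hy i (mem_univ i)
  simp only [mem_Ico] at h1 h2 h3 ⊢
  have hh : (2:ℝ) ^ (-k) = ((2 ^ m : ℤ) : ℝ) * (2:ℝ) ^ (-(k + m)) := by
    push_cast
    rw [← zpow_natCast, ← zpow_add₀ two_ne_zero]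
    congr 1; ring
  have hpos : (0:ℝ) < (2:ℝ) ^ (-(k + m)) := by positivity
  rw [hh] at h1 ⊢
  simp only [← mul_assoc] at h1 ⊢
  have e1 : n i * 2 ^ m < n' i + 1 := by
    have := lt_of_mul_lt_mul_right (h1.1.trans_lt h2.2) hpos.le
    exact_mod_cast this
  have e2 : n' i < (n i + 1) * 2 ^ m := by
    have := lt_of_mul_lt_mul_right (h2.1.trans_lt h1.2) hpos.le
    exact_mod_cast this
  have e1' : (n i : ℝ) * ((2 ^ m : ℤ) : ℝ) ≤ n' i := by exact_mod_cast Int.lt_add_one_iff.mp e1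
  have e2' : (n' i : ℝ) + 1 ≤ ((n i : ℝ) + 1) * ((2 ^ m : ℤ) : ℝ) := by
    exact_mod_cast Int.add_one_le_iff.mpr e2
  exact ⟨(mul_le_mul_of_nonneg_right e1' hpos.le).trans h3.1,
    h3.2.trans_le (mul_le_mul_of_nonneg_right e2' hpos.le)⟩

theorem dyadicCube_laminar {d : ℕ} (k k' : ℤ) (n n' : Fin d → ℤ) :
    dyadicCube d k n ⊆ dyadicCube d k' n' ∨ dyadicCube d k' n' ⊆ dyadicCube d k n ∨
      Disjoint (dyadicCube d k n) (dyadicCube d k' n') := by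
  by_cases h : Disjoint (dyadicCube d k n) (dyadicCube d k' n')
  · exact Or.inr (Or.inr h)
  obtain ⟨x, hx, hx'⟩ := not_disjoint_iff.mp h
  rcases le_total k k' with hk | hk
  · exact Or.inr (Or.inl (dyadicCube_subset_of_le hk hx hx'))
  · exact Or.inl (dyadicCube_subset_of_le hk hx' hx)

theorem IsWeight.setLIntegral_dyadicCube_ne_top {d : ℕ} {w : (Fin d → ℝ) → ℝ}
    (hw : IsWeight d w) (k : ℤ) (n : Fin d → ℤ) :
    ∫⁻ y in dyadicCube d k n, ENNReal.ofReal (w y) ≠ ⊤ := by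
  have hsub : dyadicCube d k n ⊆ Set.univ.pi fun i =>
      Set.Icc ((n i : ℝ) * (2:ℝ) ^ (-k)) (((n i : ℝ) + 1) * (2:ℝ) ^ (-k)) :=
    pi_mono fun _ _ => Ico_subset_Icc_self
  have hint : IntegrableOn w (dyadicCube d k n) :=
    (hw.2.1.integrableOn_isCompact (isCompact_univ_pi fun _ => isCompact_Icc)).mono_set hsub
  exact (lt_of_le_of_lt (lintegral_mono fun y => Real.ofReal_le_enorm _) hint.2).ne

theorem IsWeight.setLIntegral_dyadicCube_ne_zero {d : ℕ} {w : (Fin d → ℝ) → ℝ}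
    (hw : IsWeight d w) (k : ℤ) (n : Fin d → ℤ) :
    ∫⁻ y in dyadicCube d k n, ENNReal.ofReal (w y) ≠ 0 := by
  intro h
  rw [setLIntegral_eq_zero_iff (measurableSet_dyadicCube d k n) hw.1.ennreal_ofReal] at h
  refine volume_dyadicCube_ne_zero d k n (measure_mono_null ?_ (h.and hw.2.2))
  rintro x hx ⟨h1, h2⟩
  exact (ENNReal.ofReal_pos.mpr h2).ne' (h1 hx)

/-- The `A_p` condition bounds the average of the dual weight by the inverse average of `w`. -/
theorem lavg_dual_le {d : ℕ} {p : ℝ} (hp : 1 < p) {w : (Fin d → ℝ) → ℝ} (hw : IsWeight d w)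
    (k : ℤ) (n : Fin d → ℤ) :
    lavg d (fun y => w y ^ (-1 / (p - 1))) (dyadicCube d k n) ≤
      (ApChar d p w * (volume (dyadicCube d k n) *
        (∫⁻ y in dyadicCube d k n, ENNReal.ofReal (w y))⁻¹)) ^ (1 / (p - 1)) := by
  have hp1 : 0 < p - 1 := by linarith
  set Q := dyadicCube d k n with hQ
  have hA : lavg d w Q * lavg d (fun y => w y ^ (-1 / (p - 1))) Q ^ (p - 1) ≤ ApChar d p w := by
    rw [hQ, dyadicCube_eq_cube]
    exact le_iSup₂_of_le (f := fun (x : Fin d → ℝ) (h : Set.Ioi (0:ℝ)) =>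
      lavg d w (cube d x h) * (lavg d (fun y => w y ^ (-1 / (p - 1))) (cube d x h)) ^ (p - 1))
      (fun i => (n i : ℝ) * (2:ℝ) ^ (-k)) ⟨(2:ℝ) ^ (-k), by simp; positivity⟩ le_rfl
  have hV0 := volume_dyadicCube_ne_zero d k n
  have hVt := volume_dyadicCube_ne_top d k n
  have hW0 := hw.setLIntegral_dyadicCube_ne_zero k n
  have hWt := hw.setLIntegral_dyadicCube_ne_top k n
  rw [← hQ] at hV0 hVt hW0 hWt
  rw [one_div, ENNReal.le_rpow_inv_iff hp1]
  have hinv : volume Q * (∫⁻ y in Q, ENNReal.ofReal (w y))⁻¹ = (lavg d w Q)⁻¹ := by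
    rw [lavg, ENNReal.mul_inv (Or.inr hWt) (Or.inr hW0), inv_inv]
  have hL0 : lavg d w Q ≠ 0 := mul_ne_zero (ENNReal.inv_ne_zero.mpr hVt) hW0
  have hLt : lavg d w Q ≠ ⊤ := ENNReal.mul_ne_top (ENNReal.inv_ne_top.mpr hV0) hWt
  rw [hinv, ← div_eq_mul_inv, ENNReal.le_div_iff_mul_le (Or.inl hL0) (Or.inl hLt), mul_comm]
  exact hA

/-- On `I`, only the dyadic subcubes of `I` contribute to the dyadic maximal function of a
function supported on `I`. -/
theorem dyadicMax_indicator_le {d : ℕ} (g : (Fin d → ℝ) → ℝ) (k : ℤ) (n : Fin d → ℤ)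
    {x : Fin d → ℝ} (hx : x ∈ dyadicCube d k n) {b : ℝ≥0∞}
    (hb : ∀ k' n', x ∈ dyadicCube d k' n' → dyadicCube d k' n' ⊆ dyadicCube d k n →
      (volume (dyadicCube d k' n'))⁻¹ * ∫⁻ y in dyadicCube d k' n', ‖g y‖ₑ ≤ b) :
    dyadicMax d ((dyadicCube d k n).indicator g) x ≤ b := by
  refine iSup_le fun k' => iSup₂_le fun n' hx' => ?_
  rcases dyadicCube_laminar k' k n' n with h | h | h
  · refine le_trans ?_ (hb k' n' hx' h)
    gcongr with y
    exact enorm_indicator_le_enorm_self _ _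
  · refine le_trans ?_ (hb k n hx Subset.rfl)
    refine mul_le_mul' (ENNReal.inv_le_inv.mpr (measure_mono h)) ?_
    calc ∫⁻ y in dyadicCube d k' n', ‖(dyadicCube d k n).indicator g y‖ₑ
        ≤ ∫⁻ y, ‖(dyadicCube d k n).indicator g y‖ₑ := setLIntegral_le_lintegral _ _
      _ = ∫⁻ y in dyadicCube d k n, ‖g y‖ₑ := by
        simp_rw [enorm_indicator_eq_indicator_enorm]
        exact lintegral_indicator (measurableSet_dyadicCube d k n) _
  · exact absurd hx (disjoint_left.mp h hx')

/-- **Testing estimate for the dyadic maximal function for `A_p` weights.**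
For `1 < p < ∞` there is `C = C(p,d)` such that for every `w ∈ A_p` on `ℝ^d`, with dual
weight `σ := w^{1−p'} = w^{−1/(p−1)}`, and every dyadic cube `I`,
`∫_I M_𝒟(σχ_I)^p w dx ≤ C ‖w‖_{A_p}^{p'} σ(I)`. -/
theorem dyadic_maximal_testing_Ap (d : ℕ) (p : ℝ) (hp : 1 < p) :
    ∃ C : ℝ, 0 < C ∧
      ∀ w : (Fin d → ℝ) → ℝ, IsWeight d w → ApChar d p w < ⊤ →
        ∀ (k : ℤ) (n : Fin d → ℤ),
          ∫⁻ x in dyadicCube d k n,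
              (dyadicMax d
                ((dyadicCube d k n).indicator fun y => w y ^ (-1 / (p - 1))) x) ^ p *
                ENNReal.ofReal (w x) ≤
            ENNReal.ofReal C * (ApChar d p w) ^ (p / (p - 1)) *
              ∫⁻ y in dyadicCube d k n, ENNReal.ofReal (w y ^ (-1 / (p - 1))) := by

  have hp1 : 0 < p - 1 := by linarith
  set q := p / (p - 1) with hq_def
  have hq : 1 < q := by rw [hq_def, one_lt_div hp1]; linarith
  have hq0 : 0 < q := by linarith
  refine ⟨(q / (q - 1)) ^ q, Real.rpow_pos_of_pos (div_pos hq0 (by linarith)) _, ?_⟩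
  intro w hw hA k n
  set I := dyadicCube d k n with hI
  set K := ApChar d p w with hK
  have hIm : MeasurableSet I := measurableSet_dyadicCube d k n
  set W : (Fin d → ℝ) → ℝ≥0∞ := fun x => ENNReal.ofReal (w x) with hW
  have hWm : Measurable W := hw.1.ennreal_ofReal
  have hWi : Measurable fun x => (W x)⁻¹ := hWm.inv
  let ι := {a : ℤ × (Fin d → ℤ) // dyadicCube d a.1 a.2 ⊆ I}
  let J : ι → Set (Fin d → ℝ) := fun a => dyadicCube d a.1.1 a.1.2
  have hJ : ∀ a, MeasurableSet (J a) := fun a => measurableSet_dyadicCube d _ _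
  have lam : ∀ a b, J a ⊆ J b ∨ J b ⊆ J a ∨ Disjoint (J a) (J b) :=
    fun a b => dyadicCube_laminar _ _ _ _
  let c : ι → ℝ≥0 := fun a => (volume (J a) * (∫⁻ y in J a, W y)⁻¹).toNNReal
  have hc : ∀ a, (c a : ℝ≥0∞) = volume (J a) * (∫⁻ y in J a, W y)⁻¹ := fun a =>
    ENNReal.coe_toNNReal (ENNReal.mul_ne_top (volume_dyadicCube_ne_top d _ _)
      (ENNReal.inv_ne_top.mpr (hw.setLIntegral_dyadicCube_ne_zero _ _)))
  set ν := (volume.restrict I).withDensity W with hν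
  have : IsFiniteMeasure ν :=
    isFiniteMeasure_withDensity (hw.setLIntegral_dyadicCube_ne_top k n)
  have hwpos : ∀ᵐ x ∂(volume.restrict I), 0 < w x := ae_restrict_of_ae hw.2.2
  have hinv : ν.withDensity (fun x => (W x)⁻¹) = volume.restrict I :=
    withDensity_inv_same hWm (hwpos.mono fun x hx => (ENNReal.ofReal_pos.mpr hx).ne')
      (Filter.Eventually.of_forall fun x => ENNReal.ofReal_ne_top)
  have hcJ : ∀ a, c a * ν (J a) ≤ ν.withDensity (fun x => (W x)⁻¹) (J a) := by
    intro a
    rw [hinv, hν, withDensity_apply _ (hJ a), Measure.restrict_restrict (hJ a),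
      Measure.restrict_apply (hJ a), inter_eq_self_of_subset_left a.2, hc, mul_assoc,
      ENNReal.inv_mul_cancel (hw.setLIntegral_dyadicCube_ne_zero _ _)
        (hw.setLIntegral_dyadicCube_ne_top _ _), mul_one]
  have hmain := lintegral_iSup_indicator_rpow_le ν hWi hJ lam hcJ hq
  set F : (Fin d → ℝ) → ℝ≥0∞ := fun x => ⨆ a, (J a).indicator (fun _ => (c a : ℝ≥0∞)) x with hF
  have hFm : Measurable F := Measurable.iSup fun a => measurable_const.indicator (hJ a)
  have hpt : ∀ x ∈ I, dyadicMax d (I.indicator fun y => w y ^ (-1 / (p - 1))) x ≤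
      (K * F x) ^ (1 / (p - 1)) := by
    intro x hx
    refine dyadicMax_indicator_le _ k n hx fun k' n' hx' hsub => ?_
    have hdual : ∫⁻ y in dyadicCube d k' n', ‖w y ^ (-1 / (p - 1))‖ₑ =
        ∫⁻ y in dyadicCube d k' n', ENNReal.ofReal (w y ^ (-1 / (p - 1))) := by
      refine lintegral_congr_ae (ae_restrict_of_ae (hw.2.2.mono fun y hy => ?_))
      exact Real.enorm_of_nonneg (Real.rpow_nonneg hy.le _)
    rw [hdual]
    refine (lavg_dual_le hp hw k' n').trans ?_
    refine ENNReal.rpow_le_rpow (mul_le_mul_right ?_ _) (by positivity)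
    refine le_iSup_of_le (⟨(k', n'), hsub⟩ : ι) ?_
    rw [indicator_of_mem (show x ∈ J ⟨(k', n'), hsub⟩ from hx'), hc]
  have hdualInt : ∫⁻ x, (W x)⁻¹ ^ q ∂ν = ∫⁻ y in I, ENNReal.ofReal (w y ^ (-1 / (p - 1))) := by
    rw [hν, lintegral_withDensity_eq_lintegral_mul _ hWm (hWi.pow_const _)]
    refine lintegral_congr_ae (hwpos.mono fun x hx => ?_)
    have hx0 : W x ≠ 0 := (ENNReal.ofReal_pos.mpr hx).ne'
    have hxt : W x ≠ ⊤ := ENNReal.ofReal_ne_top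
    simp only [Pi.mul_apply]
    rw [← ENNReal.ofReal_rpow_of_pos hx, ENNReal.inv_rpow, ← ENNReal.rpow_neg]
    nth_rewrite 1 [← ENNReal.rpow_one (W x)]
    rw [← ENNReal.rpow_add _ _ hx0 hxt]
    congr 1
    rw [hq_def]
    field_simp
    ring
  calc ∫⁻ x in I, (dyadicMax d (I.indicator fun y => w y ^ (-1 / (p - 1))) x) ^ p *
          ENNReal.ofReal (w x)
      ≤ ∫⁻ x in I, K ^ q * (W x * F x ^ q) := by
        refine setLIntegral_mono' hIm fun x hx => ?_
        have hle := ENNReal.rpow_le_rpow (hpt x hx) (show 0 ≤ p by linarith)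
        rw [← ENNReal.rpow_mul, one_div_mul_eq_div, ENNReal.mul_rpow_of_nonneg _ _ hq0.le] at hle
        refine (mul_le_mul_left hle _).trans (le_of_eq ?_)
        rw [mul_assoc, mul_comm (F x ^ q)]
    _ = K ^ q * ∫⁻ x, F x ^ q ∂ν := by
        have hm : Measurable fun x => W x * F x ^ q := hWm.mul (hFm.pow_const _)
        rw [lintegral_const_mul _ hm, hν,
          lintegral_withDensity_eq_lintegral_mul _ hWm (hFm.pow_const _)]
        rfl
    _ ≤ K ^ q * (ENNReal.ofReal (q / (q - 1)) ^ q * ∫⁻ x, (W x)⁻¹ ^ q ∂ν) :=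
        mul_le_mul_right hmain _
    _ = _ := by
        rw [hdualInt, ENNReal.ofReal_rpow_of_pos (div_pos hq0 (by linarith))]
        ring
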